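/- arXiv:0910.3266 — 2 statements merged into one kernel-verified Lean document; each statement's English description precedes it below -/
import Mathlib

section
/- Let d ≥ 1 be an integer, α ∈ (0,2), r_1 ∈ (0, 1/2] and p > α. Then there exist δ ∈ (0, r_1/4] and a constant C > 0, depending only on α, p, d and r_1, such that for every y ∈ V_δ the limit defining the truncated fractional Laplacian Δ̂^{α/2} h_p(y) exists and |Δ̂^{α/2} h_p(y)| ≤ C. -/
open MeasureTheory Filter Set

/-- The constant 𝒜(d, -α) = α 2^{α-1} π^{-d/2} Γ((d+α)/2) Γ(1-α/2)^{-1}. -/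
noncomputable def fracConst (d : ℕ) (α : ℝ) : ℝ :=
  α * 2 ^ (α - 1) * Real.pi ^ (-(d : ℝ) / 2) *
    Real.Gamma (((d : ℝ) + α) / 2) / Real.Gamma (1 - α / 2)

/-- The Euclidean norm on ℝ^{m} × ℝ ≅ ℝ^{m+1}, writing y = (ỹ, y_d). -/
noncomputable def enorm' {m : ℕ} (y : EuclideanSpace ℝ (Fin m) × ℝ) : ℝ :=
  Real.sqrt (‖y.1‖ ^ 2 + y.2 ^ 2)

/-- The truncated integral ∫_{ε<|y-x|≤1} (u(y)-u(x)) |x-y|^{-d-α} dy on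
ℝ^{d-1} × ℝ ≅ ℝ^d, whose limit as ε ↓ 0 defines the truncated fractional Laplacian
Δ̂^{α/2}u(x) (up to the constant `fracConst d α`). -/
noncomputable def pvInt2Tr (d : ℕ) (α : ℝ)
    (u : EuclideanSpace ℝ (Fin (d - 1)) × ℝ → ℝ)
    (x : EuclideanSpace ℝ (Fin (d - 1)) × ℝ) (ε : ℝ) : ℝ :=
  ∫ y in {y : EuclideanSpace ℝ (Fin (d - 1)) × ℝ |
      ε < enorm' (y - x) ∧ enorm' (y - x) ≤ 1},
    (u y - u x) / enorm' (x - y) ^ ((d : ℝ) + α)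

/-- h_p(y) = (y_d - √(r₁² - |ỹ|²))^p on {r₁ < |y| < 3r₁/2, y_d > 0, |ỹ| < r₁/2},
and 0 otherwise. -/
noncomputable def hfun (d : ℕ) (r1 p : ℝ)
    (y : EuclideanSpace ℝ (Fin (d - 1)) × ℝ) : ℝ :=
  if r1 < enorm' y ∧ enorm' y < 3 * r1 / 2 ∧ 0 < y.2 ∧ ‖y.1‖ < r1 / 2 then
    (y.2 - Real.sqrt (r1 ^ 2 - ‖y.1‖ ^ 2)) ^ p
  else 0

theorem exists_abs_rpow_sub_taylor_le (p : ℝ) :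
    ∃ K : ℝ, 0 ≤ K ∧ ∀ x ∈ Set.Icc (1 / 2 : ℝ) (3 / 2),
      |x ^ p - 1 - p * (x - 1)| ≤ K * (x - 1) ^ 2 := by
  have lip : ∀ s : ℝ, ∃ K : ℝ, 0 ≤ K ∧ ∀ x ∈ Set.Icc (1 / 2 : ℝ) (3 / 2),
      |x ^ s - 1| ≤ K * |x - 1| := by
    intro s
    have hc : ContinuousOn (fun x : ℝ => s * x ^ (s - 1)) (Set.Icc (1 / 2 : ℝ) (3 / 2)) := by
      intro x hx
      have : x ≠ 0 := by linarith [hx.1]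
      exact (continuousAt_const.mul
        (Real.continuousAt_rpow_const _ _ (Or.inl this))).continuousWithinAt
    obtain ⟨K, hK⟩ := isCompact_Icc.exists_bound_of_continuousOn hc
    refine ⟨K, (norm_nonneg _).trans (hK 1 (by norm_num)), fun x hx => ?_⟩
    have := (convex_Icc (1 / 2 : ℝ) (3 / 2)).norm_image_sub_le_of_norm_hasDerivWithin_le
      (f := fun x : ℝ => x ^ s) (f' := fun x : ℝ => s * x ^ (s - 1)) (C := K)
      (fun z hz => (Real.hasDerivAt_rpow_const
        (Or.inl (by linarith [hz.1] : z ≠ 0))).hasDerivWithinAt)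
      hK (x := 1) (y := x) (by norm_num) hx
    simpa using this
  obtain ⟨K, hK0, hK⟩ := lip (p - 1)
  refine ⟨|p| * K, by positivity, fun x hx => ?_⟩
  have key := (convex_uIcc (1 : ℝ) x).norm_image_sub_le_of_norm_hasDerivWithin_le
    (f := fun z : ℝ => z ^ p - p * z) (f' := fun z : ℝ => p * z ^ (p - 1) - p * 1)
    (C := |p| * K * |x - 1|) (x := 1) (y := x) ?_ ?_ Set.left_mem_uIcc Set.right_mem_uIcc
  · simp only [Real.one_rpow, Real.norm_eq_abs] at key
    calc _ = |x ^ p - p * x - (1 - p * 1)| := by ring_nf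
      _ ≤ _ := key
      _ = _ := by rw [mul_assoc, abs_mul_abs_self]; ring
  all_goals
    intro z hz
    have hz1 : |z - 1| ≤ |x - 1| := Set.abs_sub_left_of_mem_uIcc hz
    have hz' : z ∈ Set.Icc (1 / 2 : ℝ) (3 / 2) :=
      Set.uIcc_subset_Icc (by norm_num) hx hz
  · exact ((Real.hasDerivAt_rpow_const (Or.inl (by linarith [hz'.1] : z ≠ 0))).sub
      ((hasDerivAt_id z).const_mul p)).hasDerivWithinAt
  · calc _ = |p| * |z ^ (p - 1) - 1| := by rw [← abs_mul, Real.norm_eq_abs]; ring_nf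
      _ ≤ |p| * (K * |x - 1|) := by gcongr; exact (hK z hz').trans (by gcongr)
      _ = _ := by ring

theorem norm_le_enorm' {m : ℕ} (w : EuclideanSpace ℝ (Fin m) × ℝ) : ‖w‖ ≤ enorm' w := by
  rw [enorm', Prod.norm_def]
  refine max_le (Real.le_sqrt_of_sq_le (by nlinarith)) (Real.le_sqrt_of_sq_le ?_)
  rw [Real.norm_eq_abs, sq_abs]
  nlinarith [sq_nonneg ‖w.1‖]

theorem enorm'_neg {m : ℕ} (w : EuclideanSpace ℝ (Fin m) × ℝ) : enorm' (-w) = enorm' w := by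
  simp [enorm']

theorem continuous_enorm' {m : ℕ} :
    Continuous (enorm' : EuclideanSpace ℝ (Fin m) × ℝ → ℝ) := by
  unfold enorm'
  fun_prop

theorem integrableOn_norm_rpow_closedBall {E : Type*} [NormedAddCommGroup E] [NormedSpace ℝ E]
    [FiniteDimensional ℝ E] [Nontrivial E] [MeasurableSpace E] [BorelSpace E]
    (μ : Measure E) [μ.IsAddHaarMeasure] {s : ℝ} (hs : -(Module.finrank ℝ E : ℝ) < s) :
    IntegrableOn (fun w : E => ‖w‖ ^ s) (Metric.closedBall 0 1) μ := by
  have h := (integrable_fun_norm_addHaar μ (F := ℝ)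
    (f := (Set.Iic (1 : ℝ)).indicator fun r => r ^ s)).2 ?_
  · rw [← integrable_indicator_iff measurableSet_closedBall]
    refine h.congr (Eventually.of_forall fun w => ?_)
    by_cases hw : ‖w‖ ≤ 1 <;> simp [Set.indicator, hw]
  · have h0 : IntegrableOn (fun r : ℝ => r ^ ((Module.finrank ℝ E : ℝ) - 1 + s))
        (Set.Ioc 0 1) :=
      (intervalIntegrable_iff_integrableOn_Ioc_of_le zero_le_one).1
        (intervalIntegral.intervalIntegrable_rpow' (by linarith))
    rw [← Set.Ioi_inter_Iic, Set.inter_comm, ← integrableOn_indicator_iff measurableSet_Iic] at h0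
    refine h0.congr_fun (fun r hr => ?_) measurableSet_Ioi
    have hr : 0 < r := hr
    by_cases hr1 : r ≤ 1
    · have h1 : ((Module.finrank ℝ E - 1 : ℕ) : ℝ) = (Module.finrank ℝ E : ℝ) - 1 := by
        rw [Nat.cast_sub Module.finrank_pos, Nat.cast_one]
      simp [Set.indicator, hr1, Real.rpow_add hr, ← h1]
    · simp [Set.indicator, hr1]

theorem isAddHaarMeasure_volume_prod (m : ℕ) :
    (volume : Measure (EuclideanSpace ℝ (Fin m) × ℝ)).IsAddHaarMeasure := by
  rw [Measure.volume_eq_prod]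
  infer_instance

theorem pvInt2Tr_eq_half_integral {d : ℕ} {α : ℝ}
    {u : EuclideanSpace ℝ (Fin (d - 1)) × ℝ → ℝ} (hα : 0 < α) (hu : Measurable u)
    (hb : ∀ z, |u z| ≤ 1) (x : EuclideanSpace ℝ (Fin (d - 1)) × ℝ) {ε : ℝ} (hε : 0 < ε) :
    pvInt2Tr d α u x ε = 2⁻¹ * ∫ w in {w : EuclideanSpace ℝ (Fin (d - 1)) × ℝ |
      ε < enorm' w ∧ enorm' w ≤ 1}, (u (x + w) + u (x - w) - 2 * u x) / enorm' w ^ ((d : ℝ) + α) := by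
  have := isAddHaarMeasure_volume_prod (d - 1)
  set S := {w : EuclideanSpace ℝ (Fin (d - 1)) × ℝ | ε < enorm' w ∧ enorm' w ≤ 1} with hS
  have hSm : MeasurableSet S :=
    (measurableSet_lt measurable_const continuous_enorm'.measurable).inter
      (measurableSet_le continuous_enorm'.measurable measurable_const)
  have hSfin : volume S < ⊤ := by
    refine (measure_mono fun w hw => ?_).trans_lt
      (measure_closedBall_lt_top (x := (0 : EuclideanSpace ℝ (Fin (d - 1)) × ℝ)) (r := 1))
    simpa using (norm_le_enorm' w).trans hw.2
  set F : EuclideanSpace ℝ (Fin (d - 1)) × ℝ → ℝ :=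
    fun w => (u (x + w) - u x) / enorm' w ^ ((d : ℝ) + α) with hF
  have hFm : Measurable F := by
    have := (continuous_enorm' (m := d - 1)).measurable
    fun_prop
  have hFi : IntegrableOn F S := by
    refine Measure.integrableOn_of_bounded (M := 2 / ε ^ ((d : ℝ) + α)) hSfin.ne
      hFm.aestronglyMeasurable ((ae_restrict_iff' hSm).2 (Eventually.of_forall fun w hw => ?_))
    have h1 : ε ^ ((d : ℝ) + α) ≤ enorm' w ^ ((d : ℝ) + α) :=
      Real.rpow_le_rpow hε.le hw.1.le (by positivity)
    have h2 := abs_le.1 (hb (x + w))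
    have h3 := abs_le.1 (hb x)
    rw [hF, Real.norm_eq_abs, abs_div, abs_of_pos ((Real.rpow_pos_of_pos hε _).trans_le h1)]
    gcongr
    exact abs_le.2 ⟨by linarith, by linarith⟩
  have hneg : ∀ w, -w ∈ S ↔ w ∈ S := fun w => by simp [hS, enorm'_neg]
  have hFi' : IntegrableOn (fun w => F (-w)) S := by
    rw [← integrable_indicator_iff hSm] at hFi ⊢
    refine hFi.comp_neg.congr (Eventually.of_forall fun w => ?_)
    by_cases hw : w ∈ S <;> simp [Set.indicator, hneg, hw]
  have e1 : pvInt2Tr d α u x ε = ∫ w in S, F w := by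
    unfold pvInt2Tr
    have hT : MeasurableSet {y : EuclideanSpace ℝ (Fin (d - 1)) × ℝ |
        ε < enorm' (y - x) ∧ enorm' (y - x) ≤ 1} := hSm.preimage (measurable_id.sub_const x)
    rw [← integral_indicator hSm, ← integral_indicator hT, ← integral_add_left_eq_self _ x]
    congr 1 with w
    simp only [Set.indicator, Set.mem_ofPred_eq, add_sub_cancel_left, hS, hF,
      sub_add_cancel_left, enorm'_neg]
  have e2 : ∫ w in S, F (-w) = ∫ w in S, F w := by
    rw [← integral_indicator hSm, ← integral_indicator hSm, ← integral_neg_eq_self]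
    congr 1 with w
    simp [Set.indicator, hneg]
  have e3 : ∫ w in S, (F w + F (-w)) = 2 * ∫ w in S, F w := by
    rw [integral_add hFi hFi', e2]; ring
  have e4 : ∀ w, (u (x + w) + u (x - w) - 2 * u x) / enorm' w ^ ((d : ℝ) + α) = F w + F (-w) := by
    intro w
    simp only [hF, enorm'_neg, ← sub_eq_add_neg]
    ring
  simp_rw [e4]
  rw [e3, e1]; ring

theorem exists_tendsto_pvInt2Tr {d : ℕ} (hd : 1 ≤ d) {α : ℝ}
    {u : EuclideanSpace ℝ (Fin (d - 1)) × ℝ → ℝ} (hα : 0 < α) (hu : Measurable u)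
    (hb : ∀ z, |u z| ≤ 1) (x : EuclideanSpace ℝ (Fin (d - 1)) × ℝ) {q K : ℝ} (hq : α < q)
    (hK : 0 ≤ K)
    (hD : ∀ w, ‖w‖ ≤ 1 → |u (x + w) + u (x - w) - 2 * u x| ≤ K * ‖w‖ ^ q) :
    ∃ L, Tendsto (pvInt2Tr d α u x) (nhdsWithin 0 (Set.Ioi 0)) (nhds L) ∧
      |L| ≤ 2⁻¹ * ∫ w in Metric.closedBall (0 : EuclideanSpace ℝ (Fin (d - 1)) × ℝ) 1,
        K * ‖w‖ ^ (q - (d + α)) := by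
  have := isAddHaarMeasure_volume_prod (d - 1)
  set G : EuclideanSpace ℝ (Fin (d - 1)) × ℝ → ℝ :=
    fun w => (u (x + w) + u (x - w) - 2 * u x) / enorm' w ^ ((d : ℝ) + α) with hG
  have hem := (continuous_enorm' (m := d - 1)).measurable
  have hGm : Measurable G := by fun_prop
  have hGb : ∀ w, ‖w‖ ≤ 1 → |G w| ≤ K * ‖w‖ ^ (q - (d + α)) := by
    intro w hw
    rcases eq_or_ne w 0 with rfl | hw0
    · simp only [hG, add_zero, sub_zero]
      rw [show u x + u x - 2 * u x = 0 by ring, zero_div, abs_zero]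
      positivity
    · have hwp : 0 < ‖w‖ := norm_pos_iff.2 hw0
      have h1 : ‖w‖ ^ ((d : ℝ) + α) ≤ enorm' w ^ ((d : ℝ) + α) :=
        Real.rpow_le_rpow hwp.le (norm_le_enorm' w) (by positivity)
      have h2 : 0 < ‖w‖ ^ ((d : ℝ) + α) := Real.rpow_pos_of_pos hwp _
      rw [hG, abs_div, abs_of_pos (h2.trans_le h1), Real.rpow_sub hwp, ← mul_div_assoc]
      exact div_le_div₀ (by positivity) (hD w hw) h2 h1
  have hfr : Module.finrank ℝ (EuclideanSpace ℝ (Fin (d - 1)) × ℝ) = d := by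
    simp; omega
  have hbi : IntegrableOn (fun w : EuclideanSpace ℝ (Fin (d - 1)) × ℝ => K * ‖w‖ ^ (q - (d + α)))
      (Metric.closedBall 0 1) :=
    (integrableOn_norm_rpow_closedBall volume (by rw [hfr]; linarith)).const_mul K
  set S : ℝ → Set (EuclideanSpace ℝ (Fin (d - 1)) × ℝ) :=
    fun ε => {w | ε < enorm' w ∧ enorm' w ≤ 1} with hS
  have hSm : ∀ ε, MeasurableSet (S ε) := fun ε =>
    (measurableSet_lt measurable_const hem).inter (measurableSet_le hem measurable_const)
  have hSb : ∀ ε w, ‖(S ε).indicator G w‖ ≤ (Metric.closedBall 0 1).indicator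
      (fun w : EuclideanSpace ℝ (Fin (d - 1)) × ℝ => K * ‖w‖ ^ (q - (d + α))) w := by
    intro ε w
    by_cases hw : w ∈ S ε
    · have hw1 : ‖w‖ ≤ 1 := (norm_le_enorm' w).trans hw.2
      simpa [Set.indicator, hw, hw1] using hGb w hw1
    · rw [Set.indicator_of_notMem hw, norm_zero]
      exact Set.indicator_nonneg (fun w _ => by positivity) w
  refine ⟨2⁻¹ * ∫ w, (S 0).indicator G w, ?_, ?_⟩
  · have hlim : Tendsto (fun ε => ∫ w, (S ε).indicator G w) (nhdsWithin 0 (Set.Ioi 0))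
        (nhds (∫ w, (S 0).indicator G w)) := by
      refine tendsto_integral_filter_of_dominated_convergence _
        (Eventually.of_forall fun ε => (hGm.indicator (hSm ε)).aestronglyMeasurable)
        (Eventually.of_forall fun ε => Eventually.of_forall (hSb ε))
        (hbi.integrable_indicator measurableSet_closedBall) (Eventually.of_forall fun w => ?_)
      refine tendsto_const_nhds.congr' ?_
      rcases lt_or_ge 0 (enorm' w) with h0 | h0
      · filter_upwards [Ioo_mem_nhdsGT h0] with ε hε
        simp [Set.indicator, hS, h0, hε.2]
      · filter_upwards [self_mem_nhdsWithin] with ε hε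
        have hε : 0 < ε := hε
        simp [Set.indicator, hS, h0.not_gt, (h0.trans hε.le).not_gt]
    refine (hlim.const_mul 2⁻¹).congr' ?_
    filter_upwards [self_mem_nhdsWithin] with ε hε
    rw [pvInt2Tr_eq_half_integral hα hu hb x hε, integral_indicator (hSm ε)]
  · rw [abs_mul, abs_of_pos (by norm_num : (0 : ℝ) < 2⁻¹),
      ← integral_indicator measurableSet_closedBall]
    gcongr
    exact norm_integral_le_of_norm_le (hbi.integrable_indicator measurableSet_closedBall)
      (Eventually.of_forall (hSb 0))

section Graph

variable {V : Type*} [NormedAddCommGroup V] {r : ℝ} {a b : V}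

theorem half_le_sqrt_sq_sub_norm_sq (hr : 0 < r) (ha : ‖a‖ < r / 2) :
    r / 2 ≤ √(r ^ 2 - ‖a‖ ^ 2) :=
  Real.le_sqrt_of_sq_le (by nlinarith [norm_nonneg a])

theorem abs_sqrt_sq_sub_norm_sq_sub_le (hr : 0 < r) (ha : ‖a‖ < r / 2) (hb : ‖b‖ < r / 2) :
    |√(r ^ 2 - ‖a‖ ^ 2) - √(r ^ 2 - ‖b‖ ^ 2)| ≤ ‖a - b‖ := by
  have h1 := half_le_sqrt_sq_sub_norm_sq hr ha
  have h2 := half_le_sqrt_sq_sub_norm_sq hr hb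
  have e1 : √(r ^ 2 - ‖a‖ ^ 2) ^ 2 = r ^ 2 - ‖a‖ ^ 2 :=
    Real.sq_sqrt (by nlinarith [norm_nonneg a])
  have e2 : √(r ^ 2 - ‖b‖ ^ 2) ^ 2 = r ^ 2 - ‖b‖ ^ 2 :=
    Real.sq_sqrt (by nlinarith [norm_nonneg b])
  set u := √(r ^ 2 - ‖a‖ ^ 2)
  set v := √(r ^ 2 - ‖b‖ ^ 2)
  have h3 : |u - v| * (u + v) = |‖a‖ - ‖b‖| * (‖a‖ + ‖b‖) := by
    have h : (u - v) * (u + v) = -((‖a‖ - ‖b‖) * (‖a‖ + ‖b‖)) := by linarith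
    have := congrArg abs h
    rwa [abs_neg, abs_mul, abs_mul, abs_of_nonneg (by linarith : 0 ≤ u + v),
      abs_of_nonneg (by positivity : 0 ≤ ‖a‖ + ‖b‖)] at this
  have h4 := abs_norm_sub_norm_le a b
  have h5 : |u - v| * r ≤ ‖a - b‖ * r :=
    calc |u - v| * r ≤ |u - v| * (u + v) := by gcongr; linarith
      _ = |‖a‖ - ‖b‖| * (‖a‖ + ‖b‖) := h3
      _ ≤ ‖a - b‖ * r := by gcongr; linarith
  exact le_of_mul_le_mul_right h5 hr

theorem abs_sqrt_sq_sub_norm_sq_second_diff_le [InnerProductSpace ℝ V] (hr : 0 < r)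
    (ha : ‖a‖ < r / 2) (hp : ‖a + b‖ < r / 2) (hm : ‖a - b‖ < r / 2) :
    |√(r ^ 2 - ‖a + b‖ ^ 2) + √(r ^ 2 - ‖a - b‖ ^ 2) - 2 * √(r ^ 2 - ‖a‖ ^ 2)|
      ≤ 4 / r * ‖b‖ ^ 2 := by
  have hc := half_le_sqrt_sq_sub_norm_sq hr ha
  have l1 := abs_sqrt_sq_sub_norm_sq_sub_le hr hp ha
  have l2 := abs_sqrt_sq_sub_norm_sq_sub_le hr hm ha
  rw [add_sub_cancel_left] at l1
  rw [sub_sub_cancel_left, norm_neg] at l2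
  have e1 : √(r ^ 2 - ‖a + b‖ ^ 2) ^ 2 = r ^ 2 - ‖a + b‖ ^ 2 :=
    Real.sq_sqrt (by nlinarith [norm_nonneg (a + b)])
  have e2 : √(r ^ 2 - ‖a - b‖ ^ 2) ^ 2 = r ^ 2 - ‖a - b‖ ^ 2 :=
    Real.sq_sqrt (by nlinarith [norm_nonneg (a - b)])
  have e3 : √(r ^ 2 - ‖a‖ ^ 2) ^ 2 = r ^ 2 - ‖a‖ ^ 2 :=
    Real.sq_sqrt (by nlinarith [norm_nonneg a])
  have hpar := parallelogram_law_with_norm ℝ a b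
  set u := √(r ^ 2 - ‖a + b‖ ^ 2)
  set v := √(r ^ 2 - ‖a - b‖ ^ 2)
  set c := √(r ^ 2 - ‖a‖ ^ 2)
  have s1 := sq_le_sq' (by linarith [neg_abs_le (u - c)]) (le_of_abs_le l1)
  have s2 := sq_le_sq' (by linarith [neg_abs_le (v - c)]) (le_of_abs_le l2)
  have key : 2 * c * (u + v - 2 * c) = -(2 * ‖b‖ ^ 2 + (u - c) ^ 2 + (v - c) ^ 2) := by
    linarith
  have h : |u + v - 2 * c| * r ≤ 4 * ‖b‖ ^ 2 := by
    calc |u + v - 2 * c| * r ≤ |u + v - 2 * c| * (2 * c) := by gcongr; linarith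
      _ = |2 * c * (u + v - 2 * c)| := by
        rw [abs_mul, abs_of_nonneg (by linarith : 0 ≤ 2 * c), mul_comm]
      _ ≤ 4 * ‖b‖ ^ 2 := by
        rw [key, abs_neg, abs_of_nonneg (by positivity)]; linarith
  rw [div_mul_eq_mul_div, le_div_iff₀ hr]
  exact h

end Graph

section Barrier

variable {d : ℕ} {r1 p : ℝ}

theorem measurable_hfun : Measurable (hfun d r1 p) := by
  have hem := (continuous_enorm' (m := d - 1)).measurable
  unfold hfun
  refine Measurable.ite ?_ (by fun_prop) measurable_const
  exact (measurableSet_lt measurable_const hem).inter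
    ((measurableSet_lt hem measurable_const).inter
    ((measurableSet_lt measurable_const measurable_snd).inter
    (measurableSet_lt measurable_fst.norm measurable_const)))

theorem snd_le_enorm' {m : ℕ} (y : EuclideanSpace ℝ (Fin m) × ℝ) : y.2 ≤ enorm' y :=
  Real.le_sqrt_of_sq_le (by nlinarith [sq_nonneg ‖y.1‖])

theorem lt_enorm'_iff {m : ℕ} {y : EuclideanSpace ℝ (Fin m) × ℝ} (hr : 0 < r1) (hy : 0 < y.2) :
    r1 < enorm' y ↔ √(r1 ^ 2 - ‖y.1‖ ^ 2) < y.2 := by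
  rw [enorm', Real.lt_sqrt hr.le, Real.sqrt_lt' hy, sub_lt_iff_lt_add, add_comm]

theorem abs_hfun_le_one (hr1 : r1 ∈ Set.Ioc (0 : ℝ) (1 / 2)) (hp : 0 ≤ p)
    (z : EuclideanSpace ℝ (Fin (d - 1)) × ℝ) : |hfun d r1 p z| ≤ 1 := by
  unfold hfun
  split_ifs with h
  · obtain ⟨h1, h2, h3, -⟩ := h
    have h0 := (lt_enorm'_iff hr1.1 h3).1 h1
    rw [abs_of_nonneg (by apply Real.rpow_nonneg; linarith)]
    refine Real.rpow_le_one (by linarith) ?_ hp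
    linarith [Real.sqrt_nonneg (r1 ^ 2 - ‖z.1‖ ^ 2), snd_le_enorm' z, hr1.2]
  · simp

theorem exists_abs_hfun_second_diff_le (hr1 : r1 ∈ Set.Ioc (0 : ℝ) (1 / 2)) (hp : 0 < p) :
    ∃ K, 0 ≤ K ∧ ∀ x : EuclideanSpace ℝ (Fin (d - 1)) × ℝ,
      0 < x.2 → r1 < enorm' x → enorm' x < r1 + r1 / 4 → ‖x.1‖ < r1 / 4 →
      ∀ w, ‖w‖ ≤ 1 → |hfun d r1 p (x + w) + hfun d r1 p (x - w) - 2 * hfun d r1 p x|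
        ≤ K * ‖w‖ ^ min p 2 := by
  obtain ⟨K, hK0, hK⟩ := exists_abs_rpow_sub_taylor_le p
  obtain ⟨hr, hr2⟩ := hr1
  refine ⟨8 * K + p * (4 / r1) + 4 * 10 ^ p, by positivity, fun x hx2 hxr hxr' hx1 w hw => ?_⟩
  set ρ : EuclideanSpace ℝ (Fin (d - 1)) × ℝ → ℝ :=
    fun z => z.2 - √(r1 ^ 2 - ‖z.1‖ ^ 2) with hρ
  have hxl := (lt_enorm'_iff hr hx2).1 hxr
  have hxe := snd_le_enorm' x
  set t := ρ x with ht
  have ht0 : 0 < t := sub_pos.2 hxl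
  have htr : t ≤ 5 / 4 * r1 := by
    have := Real.sqrt_nonneg (r1 ^ 2 - ‖x.1‖ ^ 2)
    simp only [ht, hρ]; linarith
  have ht1 : t ≤ 1 := by linarith
  have hx : hfun d r1 p x = t ^ p :=
    if_pos ⟨hxr, by linarith, hx2, by linarith⟩
  have hlip : ∀ v, ‖(x + v).1‖ < r1 / 2 → |ρ (x + v) - t| ≤ 2 * ‖v‖ := by
    intro v hv
    have h1 := abs_sqrt_sq_sub_norm_sq_sub_le hr hv (by linarith : ‖x.1‖ < r1 / 2)
    rw [Prod.fst_add, add_sub_cancel_left] at h1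
    have h2 := norm_fst_le v
    have h3 : |v.2| ≤ ‖v‖ := norm_snd_le v
    simp only [ht, hρ, Prod.fst_add, Prod.snd_add]
    rw [abs_le] at *
    constructor <;> linarith
  set s := ‖w‖ with hs
  have hsq : ∀ {y : ℝ}, 0 < y → y ≤ 1 → y ^ p ≤ y ^ min p 2 := fun h0 h1 =>
    Real.rpow_le_rpow_of_exponent_ge h0 h1 (min_le_left _ _)
  rcases lt_or_ge s (t / 8) with hst | hst
  · have hin : ∀ v, ‖v‖ = s →
        ‖(x + v).1‖ < r1 / 2 ∧ hfun d r1 p (x + v) = ρ (x + v) ^ p := by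
      intro v hv
      have h1 : ‖v.1‖ ≤ s := hv ▸ norm_fst_le v
      have h2 : |v.2| ≤ s := hv ▸ norm_snd_le v
      have h3 : ‖(x + v).1‖ ≤ ‖x.1‖ + s := (norm_add_le _ _).trans (by linarith)
      have h4 : ‖(x + v).1‖ < r1 / 2 := by linarith
      have h5 := abs_le.1 (hlip v h4)
      have h6 : 0 < ρ (x + v) := by linarith [h5.1, hv]
      have h7 : 0 < (x + v).2 :=
        (Real.sqrt_nonneg (r1 ^ 2 - ‖(x + v).1‖ ^ 2)).trans_lt (sub_pos.1 h6)
      refine ⟨h4, if_pos ⟨(lt_enorm'_iff hr h7).2 (sub_pos.1 h6), ?_, h7, h4⟩⟩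
      rw [enorm', Real.sqrt_lt' (by positivity)]
      have h8 : (x + v).2 ≤ x.2 + s := by
        rw [Prod.snd_add]; linarith [le_abs_self v.2]
      have h9 : ‖x.1‖ ^ 2 + x.2 ^ 2 < (r1 + r1 / 4) ^ 2 := (Real.sqrt_lt' (by positivity)).1 hxr'
      have hs0 : 0 ≤ s := norm_nonneg w
      have h10 : ‖(x + v).1‖ ^ 2 ≤ (‖x.1‖ + s) ^ 2 := by gcongr
      have h11 : (x + v).2 ^ 2 ≤ (x.2 + s) ^ 2 := by gcongr
      have h12 : s * (‖x.1‖ + x.2) ≤ 5 / 32 * r1 * (3 / 2 * r1) := by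
        have : 0 ≤ ‖x.1‖ := norm_nonneg _
        gcongr <;> linarith
      have h13 : s ^ 2 ≤ (5 / 32 * r1) ^ 2 := by gcongr; linarith
      nlinarith [mul_pos hr hr]
    have hs0 : 0 ≤ s := norm_nonneg w
    have htay : ∀ v, ‖v‖ = s →
        |ρ (x + v) ^ p - t ^ p - p * (t ^ p / t) * (ρ (x + v) - t)|
          ≤ 4 * K * (t ^ p * (s / t) ^ 2) := by
      intro v hv
      have h5 := hlip v (hin v hv).1
      rw [hv] at h5
      have h6 : |ρ (x + v) / t - 1| ≤ 2 * (s / t) := by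
        rw [div_sub_one ht0.ne', abs_div, abs_of_pos ht0, ← mul_div_assoc]
        gcongr
      have h7 : s / t < 1 / 8 := by rw [div_lt_iff₀ ht0]; linarith
      have h8 := abs_le.1 h6
      have h9 := hK (ρ (x + v) / t) ⟨by linarith, by linarith⟩
      have h10 : (ρ (x + v) / t - 1) ^ 2 ≤ (2 * (s / t)) ^ 2 := sq_le_sq' h8.1 h8.2
      have h11 : 0 ≤ ρ (x + v) := by linarith [(abs_le.1 h5).1]
      have h12 : 0 < t ^ p := Real.rpow_pos_of_pos ht0 p
      calc _ = t ^ p * |(ρ (x + v) / t) ^ p - 1 - p * (ρ (x + v) / t - 1)| := by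
            rw [← abs_of_pos h12, ← abs_mul, abs_of_pos h12, Real.div_rpow h11 ht0.le]
            congr 1
            field_simp
        _ ≤ t ^ p * (K * (2 * (s / t)) ^ 2) := by gcongr; exact h9.trans (by gcongr)
        _ = _ := by ring
    have hcurv : |ρ (x + w) + ρ (x - w) - 2 * t| ≤ 4 / r1 * s ^ 2 := by
      have h1 := (hin w rfl).1
      have h2 := (hin (-w) (norm_neg w)).1
      rw [← sub_eq_add_neg] at h2
      have h3 := abs_sqrt_sq_sub_norm_sq_second_diff_le hr (by linarith : ‖x.1‖ < r1 / 2) h1 h2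
      have h4 : 4 / r1 * ‖w.1‖ ^ 2 ≤ 4 / r1 * s ^ 2 := by
        gcongr; exact norm_fst_le w
      refine le_trans (le_of_eq ?_) (h3.trans h4)
      rw [← abs_neg]
      simp only [ht, hρ, Prod.fst_add, Prod.snd_add, Prod.fst_sub, Prod.snd_sub]
      congr 1
      ring
    have hscale : t ^ p * (s / t) ^ 2 ≤ s ^ min p 2 := by
      rcases hs0.eq_or_lt with h | h
      · rw [← h]; simp; positivity
      have h7 : s / t ≤ 1 := by rw [div_le_one ht0]; linarith
      calc t ^ p * (s / t) ^ 2 ≤ t ^ min p 2 * (s / t) ^ min p 2 := by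
            refine mul_le_mul (hsq ht0 ht1) ?_ (by positivity) (by positivity)
            rw [← Real.rpow_two]
            exact Real.rpow_le_rpow_of_exponent_ge (by positivity) h7 (min_le_right _ _)
        _ = s ^ min p 2 := by
            rw [← Real.mul_rpow ht0.le (by positivity), mul_div_cancel₀ _ ht0.ne']
    have hlin : |p * (t ^ p / t) * (ρ (x + w) + ρ (x - w) - 2 * t)|
        ≤ p * (4 / r1) * (t ^ p * (s / t) ^ 2) := by
      rw [abs_mul, abs_of_nonneg (by positivity)]
      calc _ ≤ p * (t ^ p / t) * (4 / r1 * s ^ 2) := by gcongr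
        _ = p * (4 / r1) * (t ^ p * (s / t) ^ 2) * t := by field_simp
        _ ≤ _ := mul_le_of_le_one_right (by positivity) ht1
    have t1 := htay w rfl
    have t2 := htay (-w) (norm_neg w)
    have e2 := (hin (-w) (norm_neg w)).2
    rw [← sub_eq_add_neg] at t2 e2
    rw [(hin w rfl).2, e2, hx]
    have h10 : (0 : ℝ) ≤ 4 * 10 ^ p * s ^ min p 2 := by positivity
    have hA : 8 * K * (t ^ p * (s / t) ^ 2) ≤ 8 * K * s ^ min p 2 := by gcongr
    have hB : p * (4 / r1) * (t ^ p * (s / t) ^ 2) ≤ p * (4 / r1) * s ^ min p 2 := by gcongr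
    rw [abs_le] at *
    constructor <;> linarith
  · have hs0 : 0 < s := by linarith
    have hb : ∀ v, ‖v‖ = s → 0 ≤ hfun d r1 p (x + v) ∧ hfun d r1 p (x + v) ≤ (10 * s) ^ p := by
      intro v hv
      by_cases h : r1 < enorm' (x + v) ∧ enorm' (x + v) < 3 * r1 / 2 ∧ 0 < (x + v).2 ∧
          ‖(x + v).1‖ < r1 / 2
      · have h0 := sub_pos.2 ((lt_enorm'_iff hr h.2.2.1).1 h.1)
        have h1 := abs_le.1 (hlip v h.2.2.2)
        rw [hfun, if_pos h]
        exact ⟨by positivity, Real.rpow_le_rpow h0.le (by simp only [hρ] at h1; linarith) hp.le⟩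
      · rw [hfun, if_neg h]
        exact ⟨le_rfl, by positivity⟩
    have b1 := hb w rfl
    have b2 := hb (-w) (norm_neg w)
    rw [← sub_eq_add_neg] at b2
    have b3 : t ^ p ≤ (10 * s) ^ p := Real.rpow_le_rpow ht0.le (by linarith) hp.le
    have b4 : 0 < t ^ p := Real.rpow_pos_of_pos ht0 p
    have b5 : (10 * s) ^ p ≤ 10 ^ p * s ^ min p 2 := by
      rw [Real.mul_rpow (by norm_num) hs0.le]
      exact mul_le_mul_of_nonneg_left (hsq hs0 hw) (by positivity)
    have b6 : 0 ≤ (8 * K + p * (4 / r1)) * s ^ min p 2 := by positivity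
    rw [hx, abs_le]
    constructor <;> linarith

end Barrier

/-- For `p > α` there exist `δ ∈ (0, r₁/4]` and a constant `C > 0` such that for every
`y` with `y_d > 0`, `r₁ < |y| < r₁ + δ`, `|ỹ| < r₁/4`, the limit defining the truncated
fractional Laplacian `Δ̂^{α/2} h_p(y)` exists and `|Δ̂^{α/2} h_p(y)| ≤ C`. -/
theorem statement7 (d : ℕ) (hd : 1 ≤ d) (α : ℝ) (hα : α ∈ Set.Ioo (0 : ℝ) 2)
    (r1 : ℝ) (hr1 : r1 ∈ Set.Ioc (0 : ℝ) (1 / 2)) (p : ℝ) (hp : α < p) :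
    ∃ δ ∈ Set.Ioc (0 : ℝ) (r1 / 4), ∃ C : ℝ, 0 < C ∧
      ∀ y : EuclideanSpace ℝ (Fin (d - 1)) × ℝ,
        0 < y.2 → r1 < enorm' y → enorm' y < r1 + δ → ‖y.1‖ < r1 / 4 →
        ∃ L : ℝ,
          Filter.Tendsto (pvInt2Tr d α (hfun d r1 p) y)
            (nhdsWithin 0 (Set.Ioi 0)) (nhds L) ∧
          |fracConst d α * L| ≤ C := by
  obtain ⟨K, hK0, hK⟩ := exists_abs_hfun_second_diff_le (d := d) hr1 (hα.1.trans hp)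
  set I := 2⁻¹ * ∫ w in Metric.closedBall (0 : EuclideanSpace ℝ (Fin (d - 1)) × ℝ) 1,
    K * ‖w‖ ^ (min p 2 - (d + α)) with hI
  have hI0 : 0 ≤ I := by
    have : 0 ≤ ∫ w in Metric.closedBall (0 : EuclideanSpace ℝ (Fin (d - 1)) × ℝ) 1,
        K * ‖w‖ ^ (min p 2 - (d + α)) := integral_nonneg fun w => by positivity
    positivity
  refine ⟨r1 / 4, ⟨by linarith [hr1.1], le_rfl⟩, |fracConst d α| * I + 1, by positivity,
    fun y hy2 hyr hyr' hy1 => ?_⟩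
  obtain ⟨L, hL, hLI⟩ := exists_tendsto_pvInt2Tr hd hα.1 measurable_hfun
    (abs_hfun_le_one hr1 (hα.1.trans hp).le) y (lt_min hp hα.2) hK0 (hK y hy2 hyr hyr' hy1)
  refine ⟨L, hL, ?_⟩
  rw [← hI] at hLI
  rw [abs_mul]
  exact (mul_le_mul_of_nonneg_left hLI (abs_nonneg _)).trans (by linarith)
end

section
/- Let L > 0, α ∈ (0,2) and q ∈ [0,1) with q + α − 1 < 1. Then the function φ(w) := ∫_0^L z^{−q} |z − w|^{−(α−1)} dz is finite for every w ∈ [0, L], is continuous on [0, L], and satisfies sup_{w ∈ [0,L]} φ(w) < ∞. -/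
open MeasureTheory Set Filter Topology

/-- Dominated convergence for nonnegative functions, with dominating functions which vary
and whose integrals converge. -/
theorem tendsto_integral_of_le_of_tendsto_integral {X ι : Type*} [MeasurableSpace X]
    {μ : Measure X} {l : Filter ι} [l.IsCountablyGenerated]
    {F G : ι → X → ℝ} {f g : X → ℝ}
    (hF : ∀ᶠ i in l, Integrable (F i) μ) (hG : ∀ᶠ i in l, Integrable (G i) μ)
    (hg : Integrable g μ)
    (hF0 : ∀ᶠ i in l, ∀ᵐ x ∂μ, 0 ≤ F i x) (hFG : ∀ᶠ i in l, ∀ᵐ x ∂μ, F i x ≤ G i x)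
    (hg0 : ∀ᵐ x ∂μ, 0 ≤ g x) (hfg : ∀ᵐ x ∂μ, f x ≤ g x)
    (hFf : ∀ᵐ x ∂μ, Tendsto (fun i => F i x) l (𝓝 (f x)))
    (hGg : ∀ᵐ x ∂μ, Tendsto (fun i => G i x) l (𝓝 (g x)))
    (hint : Tendsto (fun i => ∫ x, G i x ∂μ) l (𝓝 (∫ x, g x ∂μ))) :
    Tendsto (fun i => ∫ x, F i x ∂μ) l (𝓝 (∫ x, f x ∂μ)) := by
  have key : ∀ (H : ι → X → ℝ) (h : X → ℝ), (∀ᶠ i in l, Integrable (H i) μ) →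
      (∀ᶠ i in l, ∀ᵐ x ∂μ, 0 ≤ H i x) → (∀ᵐ x ∂μ, h x ≤ g x) →
      (∀ᵐ x ∂μ, Tendsto (fun i => H i x) l (𝓝 (h x))) →
      Tendsto (fun i => ∫ x, min (H i x) (g x) ∂μ) l (𝓝 (∫ x, h x ∂μ)) := by
    intro H h hH hH0 hhg hHh
    refine tendsto_integral_filter_of_dominated_convergence g ?_ ?_ hg ?_
    · filter_upwards [hH] with i hi
      exact (hi.inf hg).aestronglyMeasurable
    · filter_upwards [hH0] with i hi
      filter_upwards [hi, hg0] with x h1 h2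
      rw [Real.norm_of_nonneg (le_min h1 h2)]
      exact min_le_right _ _
    · filter_upwards [hhg, hHh] with x h1 h2
      simpa [min_eq_left h1] using h2.min (tendsto_const_nhds (x := g x))
  have hG0 : ∀ᶠ i in l, ∀ᵐ x ∂μ, 0 ≤ G i x := by
    filter_upwards [hF0, hFG] with i h1 h2
    filter_upwards [h1, h2] with x h3 h4 using h3.trans h4
  have h1 := key F f hF hF0 hfg hFf
  have h2 := key G g hG hG0 (ae_of_all _ fun _ => le_rfl) hGg
  have h3 := h1.add (hint.sub h2)
  rw [sub_self, add_zero] at h3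
  refine tendsto_of_tendsto_of_tendsto_of_le_of_le' h1 h3 ?_ ?_
  · filter_upwards [hF] with i hi
    exact integral_mono (hi.inf hg) hi fun x => min_le_left _ _
  · filter_upwards [hF, hG, hFG] with i hi hi' hle
    have hm : Integrable (fun x => min (F i x) (g x)) μ := hi.inf hg
    have hm' : Integrable (fun x => min (G i x) (g x)) μ := hi'.inf hg
    have hd : Integrable (fun x => G i x - min (G i x) (g x)) μ := hi'.sub hm'
    rw [← integral_sub hi' hm', ← integral_add hm hd]
    refine integral_mono_ae hi (hm.add hd) ?_
    filter_upwards [hle] with x hx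
    rcases le_total (F i x) (g x) with h | h
    · rw [min_eq_left h]
      linarith [min_le_left (G i x) (g x)]
    · rw [min_eq_right h, min_eq_right (h.trans hx)]
      linarith

theorem intervalIntegrable_abs_rpow {r : ℝ} (hr : -1 < r) (a b : ℝ) :
    IntervalIntegrable (fun x : ℝ => |x| ^ r) volume a b := by
  have hpos : ∀ c : ℝ, 0 ≤ c → IntervalIntegrable (fun x : ℝ => |x| ^ r) volume 0 c := by
    intro c hc
    refine (intervalIntegral.intervalIntegrable_rpow' hr).congr ?_
    intro x hx
    rw [uIoc_of_le hc] at hx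
    simp only [abs_of_pos hx.1]
  have hzero : ∀ c : ℝ, IntervalIntegrable (fun x : ℝ => |x| ^ r) volume 0 c := by
    intro c
    rcases le_total 0 c with hc | hc
    · exact hpos c hc
    · have := (hpos (-c) (by linarith)).comp_sub_left 0
      simpa using this
  exact (hzero a).symm.trans (hzero b)

theorem integrableOn_abs_sub_rpow {r : ℝ} (hr : -1 < r) {L : ℝ} (hL : 0 ≤ L) (w : ℝ) :
    IntegrableOn (fun z : ℝ => |z - w| ^ r) (Ioo 0 L) := by
  rw [← intervalIntegrable_iff_integrableOn_Ioo_of_le hL]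
  have := (intervalIntegrable_abs_rpow hr (0 - w) (L - w)).comp_sub_right w
  simpa using this

theorem continuous_integral_abs_sub_rpow {r : ℝ} (hr : -1 < r) {L : ℝ} (hL : 0 ≤ L) :
    Continuous fun w : ℝ => ∫ z in Ioo (0 : ℝ) L, |z - w| ^ r := by
  have hprim := intervalIntegral.continuous_primitive
    (fun a b => intervalIntegrable_abs_rpow hr a b) 0
  have heq : (fun w : ℝ => ∫ z in Ioo (0 : ℝ) L, |z - w| ^ r) = fun w =>
      (∫ x in (0 : ℝ)..(L - w), |x| ^ r) - ∫ x in (0 : ℝ)..(0 - w), |x| ^ r := by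
    funext w
    rw [← integral_Ioc_eq_integral_Ioo, ← intervalIntegral.integral_of_le hL,
      intervalIntegral.integral_interval_sub_left (intervalIntegrable_abs_rpow hr _ _)
        (intervalIntegrable_abs_rpow hr _ _),
      intervalIntegral.integral_comp_sub_right (fun x => |x| ^ r)]
  rw [heq]
  exact (hprim.comp (by fun_prop : Continuous fun w : ℝ => L - w)).sub
    (hprim.comp (by fun_prop : Continuous fun w : ℝ => 0 - w))

theorem Real.rpow_neg_mul_rpow_neg_le_add {a b s t : ℝ} (ha : 0 < a) (hb : 0 ≤ b)
    (hs : 0 ≤ s) (ht : 0 < t) :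
    a ^ (-s) * b ^ (-t) ≤ a ^ (-(s + t)) + b ^ (-(s + t)) := by
  rcases hb.eq_or_lt with rfl | hb
  · rw [Real.zero_rpow (by linarith : -t ≠ 0), mul_zero]
    positivity
  have hadd : ∀ {c : ℝ}, 0 < c → c ^ (-(s + t)) = c ^ (-s) * c ^ (-t) := fun hc => by
    rw [neg_add, Real.rpow_add hc]
  rcases le_total a b with h | h
  · have h1 : b ^ (-t) ≤ a ^ (-t) := Real.rpow_le_rpow_of_nonpos ha h (by linarith)
    have h2 : a ^ (-s) * b ^ (-t) ≤ a ^ (-s) * a ^ (-t) := by gcongr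
    rw [hadd ha]
    exact h2.trans (le_add_of_nonneg_right (by positivity))
  · have h1 : a ^ (-s) ≤ b ^ (-s) := Real.rpow_le_rpow_of_nonpos hb h (by linarith)
    have h2 : a ^ (-s) * b ^ (-t) ≤ b ^ (-s) * b ^ (-t) := by gcongr
    rw [hadd hb]
    exact h2.trans (le_add_of_nonneg_left (by positivity))

theorem exists_rpow_neg_mul_abs_sub_rpow_le {L q β : ℝ} (hL : 0 < L) (hq : q ∈ Ico (0 : ℝ) 1)
    (hqβ : q + β < 1) :
    ∃ C s : ℝ, 0 ≤ C ∧ s < 1 ∧ ∀ w ∈ Icc (0 : ℝ) L, ∀ z ∈ Ioo (0 : ℝ) L,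
      z ^ (-q) * |z - w| ^ (-β) ≤ C * (|z - 0| ^ (-s) + |z - w| ^ (-s)) := by
  rcases lt_or_ge 0 β with hβ | hβ
  · refine ⟨1, q + β, zero_le_one, hqβ, fun w _ z hz => ?_⟩
    rw [one_mul, sub_zero, abs_of_pos hz.1]
    exact Real.rpow_neg_mul_rpow_neg_le_add hz.1 (abs_nonneg _) hq.1 hβ
  · refine ⟨L ^ (-β), q, by positivity, hq.2, fun w hw z hz => ?_⟩
    have hz0 := hz.1
    have h1 : |z - w| ≤ L := abs_le.2 ⟨by linarith [hz.1, hw.2], by linarith [hz.2, hw.1]⟩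
    have h2 : |z - w| ^ (-β) ≤ L ^ (-β) :=
      Real.rpow_le_rpow (abs_nonneg _) h1 (by linarith)
    rw [sub_zero, abs_of_pos hz0, mul_comm]
    have h3 : 0 ≤ |z - w| ^ (-q) := by positivity
    gcongr
    linarith

/-- For `L > 0`, `α ∈ (0,2)`, `q ∈ [0,1)` with `q + α - 1 < 1`, the function
`φ(w) = ∫_0^L z^{-q} |z-w|^{-(α-1)} dz` is finite for every `w ∈ [0,L]`
(i.e. the integrand is integrable on `(0,L)`), is continuous on `[0,L]`,
and is bounded on `[0,L]`. -/
theorem statement10 (L : ℝ) (hL : 0 < L) (α : ℝ) (hα : α ∈ Set.Ioo (0 : ℝ) 2)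
    (q : ℝ) (hq : q ∈ Set.Ico (0 : ℝ) 1) (hqα : q + α - 1 < 1) :
    (∀ w ∈ Set.Icc (0 : ℝ) L,
        MeasureTheory.IntegrableOn
          (fun z : ℝ => z ^ (-q) * |z - w| ^ (-(α - 1))) (Set.Ioo 0 L)) ∧
    ContinuousOn
      (fun w : ℝ => ∫ z in Set.Ioo (0 : ℝ) L, z ^ (-q) * |z - w| ^ (-(α - 1)))
      (Set.Icc 0 L) ∧
    ∃ M : ℝ, ∀ w ∈ Set.Icc (0 : ℝ) L,
      (∫ z in Set.Ioo (0 : ℝ) L, z ^ (-q) * |z - w| ^ (-(α - 1))) ≤ M := by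
  obtain ⟨C, s, hC, hs, hle⟩ :=
    exists_rpow_neg_mul_abs_sub_rpow_le hL hq (by linarith : q + (α - 1) < 1)
  have hs' : -1 < -s := by linarith
  have hGint : ∀ w : ℝ, IntegrableOn
      (fun z : ℝ => C * (|z - 0| ^ (-s) + |z - w| ^ (-s))) (Ioo 0 L) := fun w =>
    ((integrableOn_abs_sub_rpow hs' hL.le 0).add
      (integrableOn_abs_sub_rpow hs' hL.le w)).const_mul C
  have hnonneg : ∀ w : ℝ, ∀ z ∈ Ioo (0 : ℝ) L, 0 ≤ z ^ (-q) * |z - w| ^ (-(α - 1)) := by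
    intro w z hz
    have := hz.1
    positivity
  have hFint : ∀ w ∈ Icc (0 : ℝ) L, IntegrableOn
      (fun z : ℝ => z ^ (-q) * |z - w| ^ (-(α - 1))) (Ioo 0 L) := by
    intro w hw
    refine Integrable.mono' (hGint w) (by fun_prop : Measurable _).aestronglyMeasurable ?_
    filter_upwards [ae_restrict_mem measurableSet_Ioo] with z hz
    rw [Real.norm_of_nonneg (hnonneg w z hz)]
    exact hle w hw z hz
  have hcont : ContinuousOn
      (fun w : ℝ => ∫ z in Ioo (0 : ℝ) L, z ^ (-q) * |z - w| ^ (-(α - 1))) (Icc 0 L) := by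
    intro w₀ hw₀
    have htend : ∀ r z : ℝ, z ≠ w₀ →
        Tendsto (fun w => |z - w| ^ r) (𝓝[Icc 0 L] w₀) (𝓝 (|z - w₀| ^ r)) := by
      intro r z hz
      have hne : |z - w₀| ≠ 0 := abs_ne_zero.2 (sub_ne_zero.2 hz)
      have : ContinuousAt (fun w => |z - w| ^ r) w₀ :=
        ContinuousAt.rpow_const (by fun_prop) (Or.inl hne)
      exact this.tendsto.mono_left nhdsWithin_le_nhds
    have hae : ∀ᵐ z ∂(volume.restrict (Ioo (0 : ℝ) L)), z ≠ w₀ :=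
      ae_restrict_of_ae (Measure.ae_ne volume w₀)
    have hmem := ae_restrict_mem (μ := volume) (measurableSet_Ioo (a := (0 : ℝ)) (b := L))
    refine tendsto_integral_of_le_of_tendsto_integral
      (G := fun w z => C * (|z - 0| ^ (-s) + |z - w| ^ (-s)))
      (g := fun z => C * (|z - 0| ^ (-s) + |z - w₀| ^ (-s)))
      (eventually_nhdsWithin_of_forall hFint) (Eventually.of_forall hGint) (hGint w₀)
      ?_ ?_ ?_ ?_ ?_ ?_ ?_
    · exact Eventually.of_forall fun w => hmem.mono (hnonneg w)
    · exact eventually_nhdsWithin_of_forall fun w hw => hmem.mono (hle w hw)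
    · exact ae_of_all _ fun z => by positivity
    · exact hmem.mono (hle w₀ hw₀)
    · filter_upwards [hae] with z hz
      exact (htend _ z hz).const_mul _
    · filter_upwards [hae] with z hz
      exact ((htend _ z hz).const_add _).const_mul _
    · have hGeq : ∀ w : ℝ, ∫ z in Ioo (0 : ℝ) L, C * (|z - 0| ^ (-s) + |z - w| ^ (-s)) =
          C * ((∫ z in Ioo (0 : ℝ) L, |z - 0| ^ (-s)) +
            ∫ z in Ioo (0 : ℝ) L, |z - w| ^ (-s)) := fun w => by
        rw [integral_const_mul, integral_add (integrableOn_abs_sub_rpow hs' hL.le 0)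
          (integrableOn_abs_sub_rpow hs' hL.le w)]
      simp only [hGeq]
      exact ((((continuous_integral_abs_sub_rpow hs' hL.le).tendsto w₀).mono_left
        nhdsWithin_le_nhds).const_add _).const_mul _
  refine ⟨hFint, hcont, ?_⟩
  obtain ⟨M, hM⟩ := isCompact_Icc.bddAbove_image hcont
  exact ⟨M, fun w hw => hM (mem_image_of_mem _ hw)⟩
end
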